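/- Let X_1,...,X_d (d ≥ 2) and Y be discrete random variables with values in finite sets, jointly distributed with strictly positive pmf P. Let μ : {2,...,d} → {1,...,d} be a mother function, i.e. μ(i) < i for all i and μ(2) = 1, and define the Generalized Naive Bayes approximation P_GNB(x_1,...,x_d,y) = ( ∏_{i=2}^d P(y, x_{μ(i)}, x_i) ) / ( ∏_{i=3}^d P(y, x_{μ(i)}) ), where the factors are marginals of P. Then KL(P ‖ P_GNB) = Σ_{i=1}^d H(X_i) + H(Y) − H(X_1,...,X_d,Y) − ( Σ_{i=2}^d I(Y, X_{μ(i)}, X_i) − Σ_{i=3}^d I(Y, X_{μ(i)}) ). -/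

import Mathlib

open scoped Classical BigOperators
open Real

noncomputable section

namespace GNB

variable {d : ℕ} {α : Fin d → Type} {β : Type} [∀ i, Fintype (α i)] [Fintype β]

/-- A joint configuration of the explanatory variables `X i` and the class variable `Y`. -/
abbrev Cfg (α : Fin d → Type) (β : Type) := ((i : Fin d) → α i) × β

/-- Marginal pmf of the class variable `Y`. -/
def margY (P : Cfg α β → ℝ) (y : β) : ℝ := ∑ x : (i : Fin d) → α i, P (x, y)

/-- Marginal pmf of the variable `X i`. -/
def margX (P : Cfg α β → ℝ) (i : Fin d) (a : α i) : ℝ :=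
  ∑ z : Cfg α β, if z.1 i = a then P z else 0

/-- Marginal pmf of the pair `(X i, Y)`. -/
def margXY (P : Cfg α β → ℝ) (i : Fin d) (a : α i) (y : β) : ℝ :=
  ∑ x : (i : Fin d) → α i, if x i = a then P (x, y) else 0

/-- Marginal pmf of the triplet `(X i, X j, Y)`. -/
def margXXY (P : Cfg α β → ℝ) (i j : Fin d) (a : α i) (b : α j) (y : β) : ℝ :=
  ∑ x : (i : Fin d) → α i, if x i = a ∧ x j = b then P (x, y) else 0

/-- Joint entropy `H(X_1,…,X_d,Y)`. -/
def HJoint (P : Cfg α β → ℝ) : ℝ := -∑ z : Cfg α β, P z * Real.log (P z)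

/-- Entropy `H(Y)`. -/
def HY (P : Cfg α β → ℝ) : ℝ := -∑ y : β, margY P y * Real.log (margY P y)

/-- Entropy `H(X i)`. -/
def HX (P : Cfg α β → ℝ) (i : Fin d) : ℝ :=
  -∑ a : α i, margX P i a * Real.log (margX P i a)

/-- Entropy `H(Y, X i)`. -/
def HYX (P : Cfg α β → ℝ) (i : Fin d) : ℝ :=
  -∑ y : β, ∑ a : α i, margXY P i a y * Real.log (margXY P i a y)

/-- Entropy `H(Y, X i, X j)`. -/
def HYXX (P : Cfg α β → ℝ) (i j : Fin d) : ℝ :=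
  -∑ y : β, ∑ a : α i, ∑ b : α j, margXXY P i j a b y * Real.log (margXXY P i j a b y)

/-- Mutual information `I(X i ; Y)`. -/
def IY2 (P : Cfg α β → ℝ) (i : Fin d) : ℝ :=
  ∑ y : β, ∑ a : α i, margXY P i a y *
    Real.log (margXY P i a y / (margX P i a * margY P y))

/-- Information content `I(Y, X i, X j)`. -/
def IY3 (P : Cfg α β → ℝ) (i j : Fin d) : ℝ :=
  ∑ y : β, ∑ a : α i, ∑ b : α j, margXXY P i j a b y *
    Real.log (margXXY P i j a b y / (margY P y * margX P i a * margX P j b))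

/-- Kullback–Leibler divergence `KL(p ‖ q)`. -/
def KL {γ : Type} [Fintype γ] (p q : γ → ℝ) : ℝ := ∑ c : γ, p c * Real.log (p c / q c)

/-- The Naive Bayes approximation `P_NB(x,y) = P(y) ∏ i, P(x i | y)`. -/
def PNB (P : Cfg α β → ℝ) : Cfg α β → ℝ :=
  fun z => margY P z.2 * ∏ i : Fin d, (margXY P i (z.1 i) z.2 / margY P z.2)

/-- The Generalized Naive Bayes approximation determined by the mother function `μ`:
`P_GNB(x,y) = (∏_{i=2}^d P(y, x_{μ i}, x_i)) / (∏_{i=3}^d P(y, x_{μ i}))`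
(indices are `0`-based: variable `X_k` of the paper is `X (k-1)` here). -/
def PGNB (P : Cfg α β → ℝ) (μ : Fin d → Fin d) : Cfg α β → ℝ :=
  fun z =>
    (∏ i ∈ Finset.univ.filter (fun i : Fin d => 1 ≤ (i : ℕ)),
        margXXY P (μ i) i (z.1 (μ i)) (z.1 i) z.2) /
    (∏ i ∈ Finset.univ.filter (fun i : Fin d => 2 ≤ (i : ℕ)),
        margXY P (μ i) (z.1 (μ i)) z.2)

/-- Predecessor on `Fin d` (truncated at `0`). -/
def pred (i : Fin d) : Fin d := ⟨(i : ℕ) - 1, lt_of_le_of_lt (Nat.sub_le _ _) i.isLt⟩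

end GNB

namespace GNB

section Marginals

variable {d : ℕ} {α : Fin d → Type} {β : Type} [∀ i, Fintype (α i)] {P : Cfg α β → ℝ}

theorem margY_pos (hpos : ∀ z, 0 < P z) (z : Cfg α β) : 0 < margY P z.2 :=
  Finset.sum_pos (fun _ _ => hpos _) ⟨z.1, Finset.mem_univ _⟩

theorem margXY_pos (hpos : ∀ z, 0 < P z) (i : Fin d) (z : Cfg α β) :
    0 < margXY P i (z.1 i) z.2 :=
  Finset.sum_pos' (fun w _ => by split_ifs <;> simp [(hpos (w, z.2)).le])
    ⟨z.1, Finset.mem_univ _, by simp [hpos]⟩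

theorem margXXY_pos (hpos : ∀ z, 0 < P z) (i j : Fin d) (z : Cfg α β) :
    0 < margXXY P i j (z.1 i) (z.1 j) z.2 :=
  Finset.sum_pos' (fun w _ => by split_ifs <;> simp [(hpos (w, z.2)).le])
    ⟨z.1, Finset.mem_univ _, by simp [hpos]⟩

theorem PGNB_pos (hpos : ∀ z, 0 < P z) (μ : Fin d → Fin d) (z : Cfg α β) : 0 < PGNB P μ z :=
  div_pos (Finset.prod_pos fun _ _ => margXXY_pos hpos _ _ z)
    (Finset.prod_pos fun _ _ => margXY_pos hpos _ z)

theorem log_PGNB (hpos : ∀ z, 0 < P z) (μ : Fin d → Fin d) (z : Cfg α β) :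
    log (PGNB P μ z) =
      ∑ i with 1 ≤ (i : Fin d).val, log (margXXY P (μ i) i (z.1 (μ i)) (z.1 i) z.2) -
        ∑ i with 2 ≤ (i : Fin d).val, log (margXY P (μ i) (z.1 (μ i)) z.2) := by
  rw [PGNB, log_div (Finset.prod_ne_zero_iff.2 fun i _ => (margXXY_pos hpos _ _ z).ne')
      (Finset.prod_ne_zero_iff.2 fun i _ => (margXY_pos hpos _ z).ne'),
    log_prod fun i _ => (margXXY_pos hpos _ _ z).ne',
    log_prod fun i _ => (margXY_pos hpos _ z).ne']

variable [Fintype β]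

theorem margX_pos (hpos : ∀ z, 0 < P z) (i : Fin d) (z : Cfg α β) : 0 < margX P i (z.1 i) :=
  Finset.sum_pos' (fun w _ => by split_ifs <;> simp [(hpos w).le])
    ⟨z, Finset.mem_univ _, by simp [hpos]⟩

theorem sum_margY_mul (P : Cfg α β → ℝ) (f : β → ℝ) :
    ∑ y, margY P y * f y = ∑ z, P z * f z.2 := by
  simp only [margY, Finset.sum_mul]
  rw [Fintype.sum_prod_type, Finset.sum_comm]

theorem sum_margX_mul (P : Cfg α β → ℝ) (i : Fin d) (f : α i → ℝ) :
    ∑ a, margX P i a * f a = ∑ z, P z * f (z.1 i) := by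
  simp only [margX, Finset.sum_mul, ite_mul, zero_mul]
  rw [Finset.sum_comm]
  simp

theorem sum_margXY_mul (P : Cfg α β → ℝ) (i : Fin d) (f : α i → β → ℝ) :
    ∑ y, ∑ a, margXY P i a y * f a y = ∑ z, P z * f (z.1 i) z.2 := by
  rw [Fintype.sum_prod_type, Finset.sum_comm (s := (Finset.univ : Finset ((i : Fin d) → α i)))]
  refine Finset.sum_congr rfl fun y _ => ?_
  simp only [margXY, Finset.sum_mul, ite_mul, zero_mul]
  rw [Finset.sum_comm]
  simp

theorem sum_margXXY_mul (P : Cfg α β → ℝ) (i j : Fin d) (f : α i → α j → β → ℝ) :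
    ∑ y, ∑ a, ∑ b, margXXY P i j a b y * f a b y = ∑ z, P z * f (z.1 i) (z.1 j) z.2 := by
  rw [Fintype.sum_prod_type, Finset.sum_comm (s := (Finset.univ : Finset ((i : Fin d) → α i)))]
  refine Finset.sum_congr rfl fun y _ => ?_
  rw [← Fintype.sum_prod_type' (f := fun a b => margXXY P i j a b y * f a b y)]
  simp only [margXXY, Finset.sum_mul, ite_mul, zero_mul]
  rw [Finset.sum_comm]
  refine Finset.sum_congr rfl fun x _ => ?_
  simp [Fintype.sum_prod_type, ite_and]

theorem IY3_eq_sum (hpos : ∀ z, 0 < P z) (i j : Fin d) :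
    IY3 P i j = ∑ z, P z * (log (margXXY P i j (z.1 i) (z.1 j) z.2) -
      (log (margY P z.2) + log (margX P i (z.1 i)) + log (margX P j (z.1 j)))) := by
  rw [IY3, sum_margXXY_mul P i j fun a b y =>
    log (margXXY P i j a b y / (margY P y * margX P i a * margX P j b))]
  refine Finset.sum_congr rfl fun z _ => ?_
  have hY := (margY_pos hpos z).ne'
  have hi := (margX_pos hpos i z).ne'
  have hj := (margX_pos hpos j z).ne'
  rw [log_div (margXXY_pos hpos i j z).ne' (mul_ne_zero (mul_ne_zero hY hi) hj),
    log_mul (mul_ne_zero hY hi) hj, log_mul hY hi]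

theorem IY2_eq_sum (hpos : ∀ z, 0 < P z) (i : Fin d) :
    IY2 P i = ∑ z, P z * (log (margXY P i (z.1 i) z.2) -
      (log (margX P i (z.1 i)) + log (margY P z.2))) := by
  rw [IY2, sum_margXY_mul P i fun a y => log (margXY P i a y / (margX P i a * margY P y))]
  refine Finset.sum_congr rfl fun z _ => ?_
  have hY := (margY_pos hpos z).ne'
  have hi := (margX_pos hpos i z).ne'
  rw [log_div (margXY_pos hpos i z).ne' (mul_ne_zero hi hY), log_mul hi hY]

end Marginals

/-- Each variable other than the first is counted once as a child; a mother is counted in both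
sums, except the mother of the second variable, which is the first variable. -/
theorem sum_child_sub_sum_mother {d : ℕ} (hd : 2 ≤ d) (μ : Fin d → Fin d)
    (hμ : ∀ i : Fin d, 0 < (i : ℕ) → μ i < i) (c : ℝ) (x : Fin d → ℝ) :
    ∑ i with 1 ≤ (i : Fin d).val, (c + x (μ i) + x i) -
      ∑ i with 2 ≤ (i : Fin d).val, (x (μ i) + c) = c + ∑ i, x i := by
  obtain ⟨n, rfl⟩ := Nat.exists_eq_add_of_le' hd
  have hμ1 : μ 1 = 0 := (Fin.lt_one_iff _).1 (hμ 1 (by simp))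
  simp only [Finset.sum_filter, Fin.sum_univ_succ]
  simp [hμ1, Finset.sum_add_distrib]
  ring

end GNB

/-- KL divergence of a Generalized Naive Bayes approximation given by a
mother function `μ` (`0`-based indices: `μ i < i` for every `i ≠ 0`, which forces
`μ` of the second variable to be the first variable):
`KL(P ‖ P_GNB) = Σᵢ H(Xᵢ) + H(Y) − H(X₁,…,X_d,Y) − (Σ_{i=2}^d I(Y,X_{μ i},Xᵢ) − Σ_{i=3}^d I(Y,X_{μ i}))`. -/
theorem kl_generalizedNaiveBayes (d : ℕ) (hd : 2 ≤ d) (α : Fin d → Type) (β : Type)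
    [∀ i, Fintype (α i)] [∀ i, Nonempty (α i)] [Fintype β] [Nonempty β]
    (P : GNB.Cfg α β → ℝ) (hpos : ∀ z, 0 < P z) (hsum : ∑ z, P z = 1)
    (μ : Fin d → Fin d) (hμ : ∀ i : Fin d, 0 < (i : ℕ) → μ i < i) :
    GNB.KL P (GNB.PGNB P μ) =
      (∑ i, GNB.HX P i) + GNB.HY P - GNB.HJoint P -
        ((∑ i ∈ Finset.univ.filter (fun i : Fin d => 1 ≤ (i : ℕ)), GNB.IY3 P (μ i) i) -
          ∑ i ∈ Finset.univ.filter (fun i : Fin d => 2 ≤ (i : ℕ)), GNB.IY2 P (μ i)) := by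
  have hIY3 : ∑ i with 1 ≤ (i : Fin d).val, GNB.IY3 P (μ i) i = ∑ z, P z *
      ∑ i with 1 ≤ (i : Fin d).val, (log (GNB.margXXY P (μ i) i (z.1 (μ i)) (z.1 i) z.2) -
        (log (GNB.margY P z.2) + log (GNB.margX P (μ i) (z.1 (μ i))) +
          log (GNB.margX P i (z.1 i)))) := by
    simp only [GNB.IY3_eq_sum hpos, Finset.mul_sum]
    exact Finset.sum_comm
  have hIY2 : ∑ i with 2 ≤ (i : Fin d).val, GNB.IY2 P (μ i) = ∑ z, P z *
      ∑ i with 2 ≤ (i : Fin d).val, (log (GNB.margXY P (μ i) (z.1 (μ i)) z.2) -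
        (log (GNB.margX P (μ i) (z.1 (μ i))) + log (GNB.margY P z.2))) := by
    simp only [GNB.IY2_eq_sum hpos, Finset.mul_sum]
    exact Finset.sum_comm
  have hHX : ∑ i, GNB.HX P i = -∑ z, P z * ∑ i, log (GNB.margX P i (z.1 i)) := by
    simp only [GNB.HX, GNB.sum_margX_mul P _ fun a => log (GNB.margX P _ a),
      Finset.sum_neg_distrib, Finset.mul_sum]
    rw [Finset.sum_comm]
  have hHY : GNB.HY P = -∑ z, P z * log (GNB.margY P z.2) := by
    rw [GNB.HY, GNB.sum_margY_mul P fun y => log (GNB.margY P y)]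
  rw [hIY3, hIY2, hHX, hHY, GNB.HJoint, GNB.KL]
  simp only [← Finset.sum_neg_distrib, ← Finset.sum_add_distrib, ← Finset.sum_sub_distrib]
  refine Finset.sum_congr rfl fun z _ => ?_
  have hcount := GNB.sum_child_sub_sum_mother hd μ hμ (log (GNB.margY P z.2))
    fun i => log (GNB.margX P i (z.1 i))
  rw [log_div (hpos z).ne' (GNB.PGNB_pos hpos μ z).ne', GNB.log_PGNB hpos,
    Finset.sum_sub_distrib, Finset.sum_sub_distrib]
  linear_combination -P z * hcount
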